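/- Transport identity: for any probability measures μ_0,…,μ_{n-1} on E_0,…,E_{n-1}, any 1 ≤ p ≤ n, and any bounded measurable F on E_0 × ⋯ × E_n, one has μ_{p-1}( D^μ_{p-1,n}(F) ) = (μ_{p-1} Q_p)( D^μ_{p,n}(F) ). -/

import Mathlib

open MeasureTheory ProbabilityTheory ENNReal

noncomputable section

variable {E : ℕ → Type*} [∀ n, MeasurableSpace (E n)]

/-- Normalization `μ / μ(1)` of a measure. -/
def nz {α : Type*} [MeasurableSpace α] (μ : Measure α) : Measure α := (μ Set.univ)⁻¹ • μ

variable (M : ∀ n, Kernel (E n) (E (n+1))) (G : ∀ n, E n → ℝ) (H : ∀ n, E n → E (n+1) → ℝ)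

/-- The Feynman-Kac kernel `Q_{q+1}(x,dy) = G_q(x) M_{q+1}(x,dy)`. -/
def Qk (q : ℕ) (x : E q) : Measure (E (q+1)) := ENNReal.ofReal (G q x) • (M q x : Measure (E (q+1)))

/-- The backward kernel `M_{q+1,η}(y,dx) = G_q(x) H_{q+1}(x,y) η(dx) / η(G_q H_{q+1}(·,y))`. -/
def Mback (q : ℕ) (η : Measure (E q)) (y : E (q+1)) : Measure (E q) :=
  (∫⁻ x, ENNReal.ofReal (G q x * H q x y) ∂η)⁻¹ •
    η.withDensity fun x => ENNReal.ofReal (G q x * H q x y)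

/-- The unnormalized Feynman-Kac marginal `γ_n = η₀ Q_{0,n}`. -/
def gamma (η0 : Measure (E 0)) : ∀ n, Measure (E n)
  | 0 => η0
  | n + 1 => (gamma η0 n).bind (Qk M G n)

/-- The Boltzmann-Gibbs transform `Ψ_{G_q}(η)(dx) = G_q(x) η(dx) / η(G_q)`. -/
def PsiG (q : ℕ) (η : Measure (E q)) : Measure (E q) :=
  (∫⁻ x, ENNReal.ofReal (G q x) ∂η)⁻¹ • η.withDensity fun x => ENNReal.ofReal (G q x)

/-- `Φ_{q+1}(η) = Ψ_{G_q}(η) M_{q+1}`. -/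
def Phi (q : ℕ) (η : Measure (E q)) : Measure (E (q+1)) :=
  (PsiG G q η).bind fun x => (M q x : Measure (E (q+1)))

/-- `η Q_{p,q}` as a measure on `E q` (junk `0` for `q < p`). -/
def QQabs (p : ℕ) (η : Measure (E p)) : ∀ q, Measure (E q)
  | 0 => if h : p = 0 then cast (congrArg (fun m => Measure (E m)) h) η else 0
  | q + 1 =>
      if h : p = q + 1 then cast (congrArg (fun m => Measure (E m)) h) η
      else (QQabs p η q).bind (Qk M G q)

/-- Forward segment integral: `x_p ↦ ∫ ∏_{p ≤ q < p+k} Q_{q+1}(x_q, dx_{q+1}) F(x_p,…,x_{p+k})`. -/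
def fwdSeg (p : ℕ) : (k : ℕ) → E p → ((∀ i : Fin (k+1), E (p + ↑i)) → ℝ) → ℝ
  | 0, x, F => F (Fin.cons x fun j => j.elim0)
  | k + 1, x, F =>
      fwdSeg p k x fun xs => ∫ y, F (Fin.snoc xs y) ∂ (Qk M G (p + k) (xs (Fin.last k)))

/-- Backward segment integral from `x_{p+k}`:
`x_{p+k} ↦ ∫ ∏_{p ≤ q < p+k} M_{q+1,θ_q}(x_{q+1}, dx_q) F(x_p,…,x_{p+k})`. -/
def bwdSeg (θ : ∀ q, Measure (E q)) (p : ℕ) :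
    (k : ℕ) → E (p + k) → ((∀ i : Fin (k+1), E (p + ↑i)) → ℝ) → ℝ
  | 0, x, F => F (Fin.cons x fun j => j.elim0)
  | k + 1, x, F =>
      ∫ y, bwdSeg θ p k y (fun xs => F (Fin.snoc xs x)) ∂ (Mback G H (p + k) (θ (p + k)) x)

/-- Backward integral from level `p` down to level `0`:
`x_p ↦ ∫ ∏_{q=1}^{p} M_{q,θ_{q-1}}(x_q, dx_{q-1}) F(x_0,…,x_p)`. -/
def bwd0 (θ : ∀ q, Measure (E q)) : (p : ℕ) → E p → ((∀ i : Fin (p+1), E ↑i) → ℝ) → ℝ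
  | 0, x, F => F (Fin.cons x fun j => j.elim0)
  | p + 1, x, F => ∫ y, bwd0 θ p y (fun xs => F (Fin.snoc xs x)) ∂ (Mback G H p (θ p) x)

/-- Integrate out the coordinates `p+1,…,n` of `F` forward through the `Q` chain. -/
def fwdAbs (p : ℕ) : (n : ℕ) → ((∀ i : Fin (n+1), E ↑i) → ℝ) → (∀ i : Fin (p+1), E ↑i) → ℝ
  | 0, F => fun xs => F fun i => xs (Fin.castLE (by omega) i)
  | n + 1, F =>
      if h : n + 1 ≤ p then fun xs => F fun i => xs (Fin.castLE (by omega) i)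
      else fwdAbs p n fun xs => ∫ y, F (Fin.snoc xs y) ∂ (Qk M G n (xs (Fin.last n)))

/-- The operator `D_{p,n}` associated to the family of backward measures `θ`. -/
def Dop (θ : ∀ q, Measure (E q)) (p n : ℕ) (F : (∀ i : Fin (n+1), E ↑i) → ℝ) (x : E p) : ℝ :=
  bwd0 G H θ p x (fwdAbs M G p n F)

/-- `Γ_n(F)`, the unnormalized Feynman-Kac path integral. -/
def GammaInt (η0 : Measure (E 0)) : (n : ℕ) → ((∀ i : Fin (n+1), E ↑i) → ℝ) → ℝ
  | 0, F => ∫ x, F (Fin.cons x fun j => j.elim0) ∂ η0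
  | n + 1, F => GammaInt η0 n fun xs => ∫ y, F (Fin.snoc xs y) ∂ (Qk M G n (xs (Fin.last n)))

/-- `Q_{p,n}(f)` acting on functions (junk `0` if `n < p`). -/
def Qfun (p : ℕ) : (n : ℕ) → (E n → ℝ) → E p → ℝ
  | 0, f => if h : p = 0 then fun x => f (cast (congrArg E h) x) else 0
  | n + 1, f =>
      if h : p = n + 1 then fun x => f (cast (congrArg E h) x)
      else Qfun p n fun x => ∫ y, f y ∂ (Qk M G n x)

/-- The composition `M_{n,θ_{n-1}} M_{n-1,θ_{n-2}} ⋯ M_{p+1,θ_p}` acting on functions on `E p`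
(identity when `n = p`, junk `0` if `n < p`). -/
def Mchain (θ : ∀ q, Measure (E q)) (p : ℕ) : (n : ℕ) → (E p → ℝ) → E n → ℝ
  | 0, f => if h : p = 0 then fun x => f (cast (congrArg E h.symm) x) else 0
  | n + 1, f =>
      if h : p = n + 1 then fun x => f (cast (congrArg E h.symm) x)
      else fun x => ∫ y, Mchain θ p n f y ∂ (Mback G H n (θ n) x)

/-- The forward recursion `F_0 = f_0`, `F_{p+1} = f_{p+1} + M_{p+1,θ_p}(F_p)`. -/
def Frec (θ : ∀ q, Measure (E q)) (f : ∀ q, E q → ℝ) : ∀ p, E p → ℝ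
  | 0 => f 0
  | p + 1 => fun x => f (p+1) x + ∫ y, Frec θ f p y ∂ (Mback G H p (θ p) x)

/-- Glue a path `(x_0,…,x_p)` with a segment `(x_p,…,x_{p+k})`. -/
def glue (p k : ℕ) (xs : ∀ i : Fin (p+1), E ↑i) (ys : ∀ i : Fin (k+1), E (p + ↑i)) :
    ∀ i : Fin (p+k+1), E ↑i := fun i =>
  if h : (i : ℕ) ≤ p then xs ⟨i, by omega⟩
  else cast (congrArg E (show p + ((i : ℕ) - p) = (i : ℕ) by omega))
    (ys ⟨(i : ℕ) - p, by have := i.isLt; omega⟩)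

/-- The oscillation `osc(f) = sup_{x,y} |f x - f y|`. -/
def osc {α : Type*} (f : α → ℝ) : ℝ := sSup {d | ∃ x y, d = |f x - f y|}

/-- The Dobrushin contraction coefficient of an operator mapping functions on `α`
to functions on `β`. -/
def betaOp {α β : Type*} [MeasurableSpace α] (T : (α → ℝ) → β → ℝ) : ℝ :=
  sSup {r | ∃ φ : α → ℝ, Measurable φ ∧ (∀ x y, |φ x - φ y| ≤ 1) ∧ r = osc (T φ)}

/-- Empirical measure of an `N`-tuple. -/
def emp {α : Type*} [MeasurableSpace α] {N : ℕ} (x : Fin N → α) : Measure α :=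
  (N : ℝ≥0∞)⁻¹ • ∑ i, Measure.dirac (x i)

lemma fwdAbs_self (n : ℕ) (F : (∀ i : Fin (n+1), E ↑i) → ℝ) : fwdAbs M G n n F = F := by
  cases n with
  | zero => rfl
  | succ n => rw [fwdAbs, dif_pos le_rfl]; rfl

lemma fwdAbs_succ_right {p n : ℕ} (h : p ≤ n) (F : (∀ i : Fin (n+1+1), E ↑i) → ℝ) :
    fwdAbs M G p (n+1) F =
      fwdAbs M G p n fun xs => ∫ y, F (Fin.snoc xs y) ∂ (Qk M G n (xs (Fin.last n))) := by
  rw [fwdAbs, dif_neg (by omega)]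

/-- Integrating out one more coordinate at the left end of the forward chain. -/
lemma fwdAbs_eq_integral_succ {p n : ℕ} (h : p < n) (F : (∀ i : Fin (n+1), E ↑i) → ℝ) :
    fwdAbs M G p n F = fun xs : ∀ i : Fin (p+1), E ↑i =>
      ∫ y, fwdAbs M G (p+1) n F (Fin.snoc xs y) ∂ (Qk M G p (xs (Fin.last p))) := by
  induction n with
  | zero => omega
  | succ n ih =>
    rw [fwdAbs_succ_right M G (by omega)]
    rcases Nat.lt_succ_iff_lt_or_eq.mp h with h' | rfl
    · rw [ih h', fwdAbs_succ_right M G (by omega)]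
    · rw [fwdAbs_self, fwdAbs_self]

lemma measurable_snoc (p : ℕ) :
    Measurable fun z : (∀ i : Fin (p+1), E ↑i) × E (p+1) =>
      (Fin.snoc z.1 z.2 : ∀ i : Fin (p+1+1), E ↑i) := by
  refine measurable_pi_lambda _ fun i => ?_
  induction i using Fin.lastCases with
  | last => simpa using measurable_snd
  | cast i =>
    simp only [Fin.snoc_castSucc]
    exact (measurable_pi_apply i).comp measurable_fst

lemma Qk_eq_withDensity (q : ℕ) (x : E q) :
    Qk M G q x = (M q x).withDensity fun _ => ENNReal.ofReal (G q x) := by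
  rw [withDensity_const]; rfl

lemma measurable_Qk [∀ q, IsMarkovKernel (M q)] (hGm : ∀ q, Measurable (G q)) (q : ℕ) :
    Measurable (Qk M G q) := by
  have hf : Measurable (Function.uncurry fun (x : E q) (_ : E (q+1)) => ENNReal.ofReal (G q x)) :=
    ((hGm q).comp measurable_fst).ennreal_ofReal
  convert (Kernel.withDensity (M q) fun x _ => ENNReal.ofReal (G q x)).measurable using 1
  ext1 x
  rw [Kernel.withDensity_apply _ hf, Qk_eq_withDensity]

/-- `Q_{q+1}` as a bundled kernel. -/
def QkKernel [∀ q, IsMarkovKernel (M q)] (hGm : ∀ q, Measurable (G q)) (q : ℕ) :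
    Kernel (E q) (E (q+1)) := ⟨Qk M G q, measurable_Qk M G hGm q⟩

lemma Qk_univ_le [∀ q, IsMarkovKernel (M q)] (hG : ∀ q x, G q x ∈ Set.Ioc (0:ℝ) 1)
    (q : ℕ) (x : E q) : Qk M G q x Set.univ ≤ 1 := by
  simpa [Qk] using (hG q x).2

lemma isFiniteKernel_QkKernel [∀ q, IsMarkovKernel (M q)] (hGm : ∀ q, Measurable (G q))
    (hG : ∀ q x, G q x ∈ Set.Ioc (0:ℝ) 1) (q : ℕ) : IsFiniteKernel (QkKernel M G hGm q) :=
  ⟨⟨1, one_lt_top, Qk_univ_le M G hG q⟩⟩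

lemma measurable_bounded_integral_Qk [∀ q, IsMarkovKernel (M q)] (hGm : ∀ q, Measurable (G q))
    (hG : ∀ q x, G q x ∈ Set.Ioc (0:ℝ) 1) (n : ℕ) {F : (∀ i : Fin (n+1+1), E ↑i) → ℝ}
    (hFm : Measurable F) (hFb : ∃ C, ∀ x, |F x| ≤ C) :
    (Measurable fun xs : ∀ i : Fin (n+1), E ↑i =>
      ∫ y, F (Fin.snoc xs y) ∂ (Qk M G n (xs (Fin.last n)))) ∧
    ∃ C, ∀ xs : ∀ i : Fin (n+1), E ↑i,
      |∫ y, F (Fin.snoc xs y) ∂ (Qk M G n (xs (Fin.last n)))| ≤ C := by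
  have := isFiniteKernel_QkKernel M G hGm hG n
  constructor
  · have hlast : Measurable fun xs : ∀ i : Fin (n+1), E ↑i => xs (Fin.last n) :=
      measurable_pi_apply _
    exact ((hFm.comp (measurable_snoc n)).stronglyMeasurable.integral_kernel_prod_right'
      (κ := (QkKernel M G hGm n).comap _ hlast)).measurable
  · obtain ⟨C, hC⟩ := hFb
    refine ⟨|C|, fun xs => ?_⟩
    have hfin : IsFiniteMeasure (Qk M G n (xs (Fin.last n))) :=
      ⟨(Qk_univ_le M G hG n _).trans_lt one_lt_top⟩
    refine (norm_integral_le_of_norm_le_const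
      (f := fun y => F (Fin.snoc xs y)) (C := |C|)
      (.of_forall fun y => (hC (Fin.snoc xs y)).trans (le_abs_self C))).trans ?_
    exact mul_le_of_le_one_right (abs_nonneg C)
      (ENNReal.toReal_le_of_le_ofReal zero_le_one (by simpa using Qk_univ_le M G hG n _))

lemma measurable_bounded_fwdAbs [∀ q, IsMarkovKernel (M q)] (hGm : ∀ q, Measurable (G q))
    (hG : ∀ q x, G q x ∈ Set.Ioc (0:ℝ) 1) {p n : ℕ} (h : p ≤ n)
    {F : (∀ i : Fin (n+1), E ↑i) → ℝ} (hFm : Measurable F) (hFb : ∃ C, ∀ x, |F x| ≤ C) :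
    Measurable (fwdAbs M G p n F) ∧ ∃ C, ∀ xs, |fwdAbs M G p n F xs| ≤ C := by
  induction n, h using Nat.le_induction with
  | base => rw [fwdAbs_self]; exact ⟨hFm, hFb⟩
  | succ n h ih =>
    rw [fwdAbs_succ_right M G h]
    obtain ⟨hm, hb⟩ := measurable_bounded_integral_Qk M G hGm hG n hFm hFb
    exact ih hm hb

lemma measurable_potential (hGm : ∀ q, Measurable (G q))
    (hHm : ∀ q, Measurable (Function.uncurry (H q))) (q : ℕ) :
    Measurable fun z : E (q+1) × E q => ENNReal.ofReal (G q z.2 * H q z.2 z.1) :=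
  (((hGm q).comp measurable_snd).mul
    ((hHm q).comp (measurable_snd.prodMk measurable_fst))).ennreal_ofReal

lemma measurable_Mback (hGm : ∀ q, Measurable (G q))
    (hHm : ∀ q, Measurable (Function.uncurry (H q))) (q : ℕ) (η : Measure (E q)) [SFinite η] :
    Measurable (Mback G H q η) := by
  have hu := measurable_potential G H hGm hHm q
  have hc : Measurable fun y => (∫⁻ x, ENNReal.ofReal (G q x * H q x y) ∂η)⁻¹ :=
    hu.lintegral_prod_right'.inv
  have hf : Measurable (Function.uncurry fun (y : E (q+1)) (x : E q) =>
      (∫⁻ x, ENNReal.ofReal (G q x * H q x y) ∂η)⁻¹ * ENNReal.ofReal (G q x * H q x y)) :=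
    (hc.comp measurable_fst).mul hu
  convert (Kernel.withDensity (Kernel.const (E (q+1)) η) fun y x =>
    (∫⁻ x, ENNReal.ofReal (G q x * H q x y) ∂η)⁻¹ * ENNReal.ofReal (G q x * H q x y)).measurable
    using 1
  ext1 y
  have hy : Measurable fun x => ENNReal.ofReal (G q x * H q x y) := hu.comp measurable_prodMk_left
  rw [Kernel.withDensity_apply _ hf, Kernel.const_apply, Mback,
    ← withDensity_smul _ hy]
  rfl

/-- The backward kernel `M_{q+1,η}` as a bundled kernel. -/
def MbackKernel (hGm : ∀ q, Measurable (G q)) (hHm : ∀ q, Measurable (Function.uncurry (H q)))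
    (q : ℕ) (η : Measure (E q)) [SFinite η] : Kernel (E (q+1)) (E q) :=
  ⟨Mback G H q η, measurable_Mback G H hGm hHm q η⟩

lemma lintegral_potential_ne_zero (hGm : ∀ q, Measurable (G q))
    (hG : ∀ q x, G q x ∈ Set.Ioc (0:ℝ) 1)
    (hHm : ∀ q, Measurable (Function.uncurry (H q))) (hHpos : ∀ q x y, 0 < H q x y)
    (q : ℕ) (η : Measure (E q)) [IsProbabilityMeasure η] (y : E (q+1)) :
    ∫⁻ x, ENNReal.ofReal (G q x * H q x y) ∂η ≠ 0 := by
  have hu : Measurable fun x => ENNReal.ofReal (G q x * H q x y) :=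
    (measurable_potential G H hGm hHm q).comp measurable_prodMk_left
  have hpos (x : E q) : ENNReal.ofReal (G q x * H q x y) ≠ 0 := by
    simpa using mul_pos (hG q x).1 (hHpos q x y)
  rw [Ne, lintegral_eq_zero_iff hu]
  intro h
  exact IsProbabilityMeasure.ne_zero η
    (ae_eq_bot.mp (Filter.eventually_false_iff_eq_bot.mp (h.mono fun x hx => hpos x hx)))

lemma isMarkovKernel_MbackKernel (hGm : ∀ q, Measurable (G q))
    (hG : ∀ q x, G q x ∈ Set.Ioc (0:ℝ) 1)
    (hHm : ∀ q, Measurable (Function.uncurry (H q))) (hHpos : ∀ q x y, 0 < H q x y)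
    (hHint : ∀ q (η : Measure (E q)), IsProbabilityMeasure η → ∀ y,
      ∫⁻ x, ENNReal.ofReal (G q x * H q x y) ∂η < ⊤)
    (q : ℕ) (η : Measure (E q)) [IsProbabilityMeasure η] :
    IsMarkovKernel (MbackKernel G H hGm hHm q η) := by
  refine ⟨fun y => ⟨?_⟩⟩
  change Mback G H q η y Set.univ = 1
  rw [Mback, Measure.smul_apply, withDensity_apply _ .univ, Measure.restrict_univ, smul_eq_mul]
  exact ENNReal.inv_mul_cancel (lintegral_potential_ne_zero G H hGm hG hHm hHpos q η y)
    (hHint q η inferInstance y).ne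

/-- `bwd0 p x F` only depends on the values of `F` on paths ending at `x`. -/
lemma bwd0_congr (θ : ∀ q, Measure (E q)) (p : ℕ) (x : E p) {F F' : (∀ i : Fin (p+1), E ↑i) → ℝ}
    (h : ∀ xs : ∀ i : Fin (p+1), E ↑i, xs (Fin.last p) = x → F xs = F' xs) :
    bwd0 G H θ p x F = bwd0 G H θ p x F' := by
  cases p with
  | zero => exact h _ rfl
  | succ p =>
    have : (fun xs : ∀ i : Fin (p+1), E ↑i => F (Fin.snoc xs x)) = fun xs => F' (Fin.snoc xs x) :=
      funext fun xs => h _ (Fin.snoc_last (α := fun i : Fin (p+1+1) => E ↑i) x xs)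
    exact congrArg (fun f => ∫ y, bwd0 G H θ p y f ∂(Mback G H p (θ p) x)) this

/-- The law of the backward path `(x_0,…,x_p)` is a Markov kernel in its endpoint `x_p`. -/
lemma exists_kernel_bwd0 (hGm : ∀ q, Measurable (G q)) (hG : ∀ q x, G q x ∈ Set.Ioc (0:ℝ) 1)
    (hHm : ∀ q, Measurable (Function.uncurry (H q))) (hHpos : ∀ q x y, 0 < H q x y)
    (hHint : ∀ q (η : Measure (E q)), IsProbabilityMeasure η → ∀ y,
      ∫⁻ x, ENNReal.ofReal (G q x * H q x y) ∂η < ⊤)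
    (θ : ∀ q, Measure (E q)) [∀ q, IsProbabilityMeasure (θ q)] (p : ℕ) :
    ∃ B : Kernel (E p) (∀ i : Fin (p+1), E ↑i), IsMarkovKernel B ∧
      ∀ x (F : (∀ i : Fin (p+1), E ↑i) → ℝ), Measurable F → (∃ C, ∀ xs, |F xs| ≤ C) →
        bwd0 G H θ p x F = ∫ xs, F xs ∂(B x) := by
  induction p with
  | zero =>
    have hm : Measurable fun x : E 0 => (Fin.cons x fun j => j.elim0 : ∀ i : Fin 1, E ↑i) := by
      refine measurable_pi_lambda _ fun i => ?_
      induction i using Fin.cases with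
      | zero => exact measurable_id
      | succ j => exact j.elim0
    refine ⟨Kernel.deterministic _ hm, inferInstance, fun x F hF _ => ?_⟩
    rw [Kernel.integral_deterministic' hm hF.stronglyMeasurable]
    rfl
  | succ p ih =>
    obtain ⟨B, hB, hBF⟩ := ih
    have := isMarkovKernel_MbackKernel G H hGm hG hHm hHpos hHint p (θ p)
    refine ⟨((B ∘ₖ MbackKernel G H hGm hHm p (θ p)) ×ₖ Kernel.id).map
      fun z => Fin.snoc z.1 z.2, Kernel.IsMarkovKernel.map _ (measurable_snoc p), fun x F hF ⟨C, hC⟩ => ?_⟩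
    have hFx : Measurable fun xs : ∀ i : Fin (p+1), E ↑i => F (Fin.snoc xs x) :=
      (hF.comp (measurable_snoc p)).comp measurable_prodMk_right
    have hFs : Measurable fun z : (∀ i : Fin (p+1), E ↑i) × E (p+1) => F (Fin.snoc z.1 z.2) :=
      hF.comp (measurable_snoc p)
    have hint (ν : Measure (∀ i : Fin (p+1), E ↑i)) [IsFiniteMeasure ν] :
        Integrable (fun xs => F (Fin.snoc xs x)) ν :=
      .of_bound hFx.aestronglyMeasurable C (.of_forall fun _ => hC _)
    rw [Kernel.map_apply _ (measurable_snoc p), Kernel.prod_apply, Kernel.id_apply,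
      integral_map (measurable_snoc p).aemeasurable hF.aestronglyMeasurable, Measure.prod_dirac,
      integral_map measurable_prodMk_right.aemeasurable hFs.aestronglyMeasurable]
    exact (integral_congr_ae (.of_forall fun y => hBF y _ hFx ⟨C, fun _ => hC _⟩)).trans
      (Kernel.integral_comp (κ := MbackKernel G H hGm hHm p (θ p)) (η := B) (hint _)).symm

/-- The duality `η(dx) Q_{q+1}(x,dy) = (η Q_{q+1})(dy) M_{q+1,η}(y,dx)`. -/
lemma compProd_QkKernel_eq_map_swap [∀ q, IsMarkovKernel (M q)]
    (lam : ∀ n, Measure (E n)) [∀ n, SigmaFinite (lam n)]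
    (hGm : ∀ q, Measurable (G q)) (hG : ∀ q x, G q x ∈ Set.Ioc (0:ℝ) 1)
    (hHm : ∀ q, Measurable (Function.uncurry (H q))) (hHpos : ∀ q x y, 0 < H q x y)
    (hMH : ∀ q x, (M q x : Measure (E (q+1)))
      = (lam (q+1)).withDensity fun y => ENNReal.ofReal (H q x y))
    (hHint : ∀ q (η : Measure (E q)), IsProbabilityMeasure η → ∀ y,
      ∫⁻ x, ENNReal.ofReal (G q x * H q x y) ∂η < ⊤)
    (q : ℕ) (η : Measure (E q)) [IsProbabilityMeasure η] :
    η ⊗ₘ QkKernel M G hGm q =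
      ((η.bind (Qk M G q)) ⊗ₘ MbackKernel G H hGm hHm q η).map Prod.swap := by
  have := isFiniteKernel_QkKernel M G hGm hG q
  have := isMarkovKernel_MbackKernel G H hGm hG hHm hHpos hHint q η
  have : IsFiniteMeasure (η.bind (Qk M G q)) :=
    inferInstanceAs (IsFiniteMeasure (η.bind (QkKernel M G hGm q)))
  have hu := measurable_potential G H hGm hHm q
  have huy (y : E (q+1)) : Measurable fun x => ENNReal.ofReal (G q x * H q x y) :=
    hu.comp measurable_prodMk_left
  have hQ (x : E q) (φ : E (q+1) → ℝ≥0∞) (hφ : Measurable φ) :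
      ∫⁻ y, φ y ∂(Qk M G q x) = ∫⁻ y, ENNReal.ofReal (G q x * H q x y) * φ y ∂(lam (q+1)) := by
    have hH : Measurable fun y => ENNReal.ofReal (H q x y) :=
      ((hHm q).comp measurable_prodMk_left).ennreal_ofReal
    rw [Qk, lintegral_smul_measure, hMH, lintegral_withDensity_eq_lintegral_mul _ hH hφ,
      smul_eq_mul, ← lintegral_const_mul _ (hH.mul hφ)]
    simp [ENNReal.ofReal_mul (hG q x).1.le, mul_assoc]
  have hMb (y : E (q+1)) (φ : E q → ℝ≥0∞) (hφ : Measurable φ) :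
      ∫⁻ x, φ x ∂(Mback G H q η y) = (∫⁻ x, ENNReal.ofReal (G q x * H q x y) ∂η)⁻¹ *
        ∫⁻ x, ENNReal.ofReal (G q x * H q x y) * φ x ∂η := by
    rw [Mback, lintegral_smul_measure,
      lintegral_withDensity_eq_lintegral_mul _ (huy y) hφ]
    rfl
  refine Measure.ext_of_lintegral _ fun f hf => ?_
  have hfs : Measurable fun z : E (q+1) × E q => f z.swap := hf.comp measurable_swap
  have hφ : Measurable fun y => ∫⁻ x, f (x, y) ∂(Mback G H q η y) :=
    Measurable.lintegral_kernel_prod_right' (κ := MbackKernel G H hGm hHm q η) hfs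
  rw [lintegral_map hf measurable_swap, Measure.lintegral_compProd hf,
    Measure.lintegral_compProd hfs]
  change ∫⁻ x, ∫⁻ y, f (x, y) ∂(Qk M G q x) ∂η =
    ∫⁻ y, ∫⁻ x, f (x, y) ∂(Mback G H q η y) ∂(η.bind (Qk M G q))
  rw [Measure.lintegral_bind (measurable_Qk M G hGm q).aemeasurable hφ.aemeasurable]
  have hfx (x : E q) : Measurable fun y => f (x, y) := hf.comp measurable_prodMk_left
  rw [lintegral_congr fun x => hQ x _ (hfx x), lintegral_congr fun x => hQ x _ hφ]
  have hus : Measurable fun z : E q × E (q+1) => ENNReal.ofReal (G q z.1 * H q z.1 z.2) :=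
    hu.comp measurable_swap
  refine (lintegral_lintegral_swap (hus.mul hf).aemeasurable).trans
    (.trans (lintegral_congr fun y => ?_)
      (lintegral_lintegral_swap (hus.mul (hφ.comp measurable_snd)).aemeasurable).symm)
  have hfy : Measurable fun x => f (x, y) := hf.comp measurable_prodMk_right
  rw [lintegral_mul_const _ (huy y), hMb y _ hfy, ← mul_assoc,
    ENNReal.mul_inv_cancel (lintegral_potential_ne_zero G H hGm hG hHm hHpos q η y)
      (hHint q η inferInstance y).ne, one_mul]

/-- transport identity. For any probability measures `μ_0,…,μ_{n-1}`,
any `1 ≤ p ≤ n` (written here with `q := p - 1 < n`) and bounded measurable `F`: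
`μ_{p-1}(D^μ_{p-1,n}(F)) = (μ_{p-1} Q_p)(D^μ_{p,n}(F))`. -/
theorem transport_identity
    (lam : ∀ n, Measure (E n))
    (hM : ∀ q, IsMarkovKernel (M q))
    (hGm : ∀ q, Measurable (G q)) (hG : ∀ q x, G q x ∈ Set.Ioc (0:ℝ) 1)
    (hHm : ∀ q, Measurable (Function.uncurry (H q)))
    (hHpos : ∀ q x y, 0 < H q x y)
    (hlam : ∀ n, SigmaFinite (lam n))
    (hMH : ∀ q x, (M q x : Measure (E (q+1)))
      = (lam (q+1)).withDensity fun y => ENNReal.ofReal (H q x y))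
    (hHint : ∀ q (η : Measure (E q)), IsProbabilityMeasure η → ∀ y,
      ∫⁻ x, ENNReal.ofReal (G q x * H q x y) ∂η < ⊤)
    (n : ℕ) (μ : ∀ q, Measure (E q)) (hμ : ∀ q, IsProbabilityMeasure (μ q))
    (q : ℕ) (hq : q < n)
    (F : (∀ i : Fin (n+1), E ↑i) → ℝ) (hFm : Measurable F) (hFb : ∃ C, ∀ x, |F x| ≤ C) :
    ∫ x, Dop M G H μ q n F x ∂ (μ q)
      = ∫ x, Dop M G H μ (q+1) n F x ∂ ((μ q).bind (Qk M G q)) := by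
  obtain ⟨B, hB, hBF⟩ := exists_kernel_bwd0 G H hGm hG hHm hHpos hHint μ q
  obtain ⟨hgm, C, hC⟩ := measurable_bounded_fwdAbs M G hGm hG (Nat.succ_le_of_lt hq) hFm hFb
  set g := fwdAbs M G (q+1) n F with hg
  have := isFiniteKernel_QkKernel M G hGm hG q
  have := isMarkovKernel_MbackKernel G H hGm hG hHm hHpos hHint q (μ q)
  have : IsFiniteMeasure ((μ q).bind (Qk M G q)) :=
    inferInstanceAs (IsFiniteMeasure ((μ q).bind (QkKernel M G hGm q)))
  have hgs : Measurable fun z : (∀ i : Fin (q+1), E ↑i) × E (q+1) => g (Fin.snoc z.1 z.2) :=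
    hgm.comp (measurable_snoc q)
  have hfin (x : E q) : IsFiniteMeasure (Qk M G q x) :=
    inferInstanceAs (IsFiniteMeasure (QkKernel M G hGm q x))
  have hgy (y : E (q+1)) (x : E q) : bwd0 G H μ q x (fun xs => g (Fin.snoc xs y)) =
      ∫ xs, g (Fin.snoc xs y) ∂(B x) :=
    hBF x _ (hgs.comp measurable_prodMk_right) ⟨C, fun _ => hC _⟩
  let h : E q × E (q+1) → ℝ := fun z => ∫ xs, g (Fin.snoc xs z.2) ∂(B z.1)
  have hhm : Measurable h :=
    (StronglyMeasurable.integral_kernel_prod_right' (κ := B.comap Prod.fst measurable_fst)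
      (f := fun w : (E q × E (q+1)) × (∀ i : Fin (q+1), E ↑i) => g (Fin.snoc w.2 w.1.2))
      (hgs.comp (measurable_snd.prodMk measurable_fst.snd)).stronglyMeasurable).measurable
  have hhint (ν : Measure (E q × E (q+1))) [IsFiniteMeasure ν] : Integrable h ν := by
    refine .of_bound hhm.aestronglyMeasurable C (.of_forall fun z => ?_)
    simpa using norm_integral_le_of_norm_le_const (μ := B z.1)
      (f := fun xs => g (Fin.snoc xs z.2)) (.of_forall fun xs => hC (Fin.snoc xs z.2))
  have hleft (x : E q) : Dop M G H μ q n F x = ∫ y, h (x, y) ∂(Qk M G q x) := by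
    have hxm : Measurable fun xs : ∀ i : Fin (q+1), E ↑i =>
        ∫ y, g (Fin.snoc xs y) ∂(Qk M G q x) :=
      hgs.stronglyMeasurable.integral_prod_right'.measurable
    have hxb : ∃ C', ∀ xs : ∀ i : Fin (q+1), E ↑i,
        |∫ y, g (Fin.snoc xs y) ∂(Qk M G q x)| ≤ C' :=
      ⟨_, fun xs => norm_integral_le_of_norm_le_const
        (f := fun y => g (Fin.snoc xs y)) (.of_forall fun y => hC (Fin.snoc xs y))⟩
    rw [Dop, fwdAbs_eq_integral_succ M G hq,
      bwd0_congr G H μ q x (F' := fun xs => ∫ y, g (Fin.snoc xs y) ∂(Qk M G q x))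
        (fun xs hxs => by rw [hxs]), hBF x _ hxm hxb]
    exact integral_integral_swap
      (.of_bound hgs.aestronglyMeasurable C (.of_forall fun _ => hC _))
  have hright (y : E (q+1)) :
      Dop M G H μ (q+1) n F y = ∫ x, h (x, y) ∂(Mback G H q (μ q) y) :=
    integral_congr_ae (.of_forall fun x => hgy y x)
  calc ∫ x, Dop M G H μ q n F x ∂(μ q)
      = ∫ z, h z ∂((μ q) ⊗ₘ QkKernel M G hGm q) := by
        rw [Measure.integral_compProd (hhint _)]
        exact integral_congr_ae (.of_forall hleft)
    _ = ∫ z, h z.swap ∂(((μ q).bind (Qk M G q)) ⊗ₘ MbackKernel G H hGm hHm q (μ q)) := by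
        rw [compProd_QkKernel_eq_map_swap M G H lam hGm hG hHm hHpos hMH hHint,
          integral_map measurable_swap.aemeasurable hhm.aestronglyMeasurable]
    _ = ∫ y, Dop M G H μ (q+1) n F y ∂((μ q).bind (Qk M G q)) := by
        rw [Measure.integral_compProd (f := fun z => h z.swap)
          ((hhint _).comp_measurable measurable_swap)]
        exact integral_congr_ae (.of_forall fun y => (hright y).symm)

end
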